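/- For all m ≥ 4, the number r_0(m) satisfies the lower bound 2·(3/4)^{m−4}·((m−3)!)² ≤ r_0(m). -/

import Mathlib

/-- The union of the hyperplanes of the braid arrangement `B_m` in `ℝ^m`:
`x_i = x_j` for `1 ≤ i < j ≤ m`. -/
def braidUnion (m : ℕ) : Set (Fin m → ℝ) :=
  ⋃ i : Fin m, ⋃ j : Fin m, ⋃ _ : i < j, {x | x i = x j}

/-- The union of the hyperplanes of the arrangement `N_m` in `ℝ^m`:
`x_i + x_j = x_k + x_l` for quadruples of distinct indices `(i,j,k,l)` with
`i < j`, `i < k < l`. -/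
def midUnion (m : ℕ) : Set (Fin m → ℝ) :=
  ⋃ i : Fin m, ⋃ j : Fin m, ⋃ k : Fin m, ⋃ l : Fin m,
    ⋃ _ : i < j, ⋃ _ : i < k, ⋃ _ : k < l, ⋃ _ : j ≠ k, ⋃ _ : j ≠ l,
      {x | x i + x j = x k + x l}

/-- The union of the hyperplanes of the mid-hyperplane arrangement
`M_m = B_m ∪ N_m`. -/
def midHyperplaneUnion (m : ℕ) : Set (Fin m → ℝ) :=
  braidUnion m ∪ midUnion m

/-- The chamber `C_0 = {x : x_1 < ⋯ < x_m}` of the braid arrangement. -/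
def C0 (m : ℕ) : Set (Fin m → ℝ) := {x | StrictMono x}

/-- The ranking pattern of the unidimensional unfolding model with objects
`x_1, …, x_m ∈ ℝ`: the set of rankings `(i_1 ⋯ i_m)` (permutations of
`{1,…,m}`, where `σ k = i_k`) such that
`|y - x_{i_1}| < ⋯ < |y - x_{i_m}|` for some `y ∈ ℝ`. -/
def RPUF {m : ℕ} (x : Fin m → ℝ) : Set (Equiv.Perm (Fin m)) :=
  {σ | ∃ y : ℝ, ∀ k l : Fin m, k < l → |y - x (σ k)| < |y - x (σ l)|}

/-- The chambers of an arrangement with union of hyperplanes `U`: the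
connected components of the complement of `U`. -/
def chambersOf {m : ℕ} (U : Set (Fin m → ℝ)) : Set (Set (Fin m → ℝ)) :=
  {C | ∃ y ∈ Uᶜ, C = connectedComponentIn Uᶜ y}

/-- `r_0(m)`: the number of ranking patterns of unidimensional unfolding
models with generic `m`-tuples such that `x_1 < ⋯ < x_m`. -/
noncomputable def r0 (m : ℕ) : ℕ :=
  {R : Set (Equiv.Perm (Fin m)) | ∃ x ∈ C0 m \ midUnion m, R = RPUF x}.ncard

open Finset in
/-- The number of triples `i < k < l` with `x_k + x_l - x_i > y`. -/
noncomputable def tripleCount {m : ℕ} (x : Fin m → ℝ) (y : ℝ) : ℕ :=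
  #{p : Fin m × Fin m × Fin m | (p.1 < p.2.1 ∧ p.2.1 < p.2.2) ∧ x p.1 + y < x p.2.1 + x p.2.2}

/-- `tripleCount` of the last coordinate with respect to the other ones. -/
noncomputable def lastTripleCount {m : ℕ} (x : Fin (m + 1) → ℝ) : ℕ :=
  tripleCount (Fin.init x) (x (Fin.last m))

/-- Two tuples order the midpoints of pairs of their entries in the same way. -/
def SameMidOrder {m : ℕ} (x x' : Fin m → ℝ) : Prop :=
  ∀ i j k l : Fin m, i < l → j < k → (x i + x l < x j + x k ↔ x' i + x' l < x' j + x' k)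

/-- A finite set of increasing, rationally independent tuples with pairwise different
midpoint orders. -/
structure IsIndependentFamily {m : ℕ} (S : Finset (Fin m → ℝ)) : Prop where
  strictMono : ∀ x ∈ S, StrictMono x
  linearIndependent : ∀ x ∈ S, LinearIndependent ℚ x
  eq_of_same : ∀ x ∈ S, ∀ x' ∈ S, SameMidOrder x x' → x = x'

theorem exists_mem_Ioo_notMem {C : Set ℝ} (hC : C.Countable) {a b : ℝ} (hab : a < b) :
    ∃ y ∈ Set.Ioo a b, y ∉ C := by
  by_contra! h
  have : (Set.Ioo a b).Countable := hC.mono h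
  exact hab.not_ge (Cardinal.Real.Ioo_countable_iff.mp this)

theorem exists_gt_card_filter_eq {C : Set ℝ} (hC : C.Countable) (F : Finset ℝ) :
    ∀ a : ℝ, (∀ v ∈ F, a < v) → ∀ j ≤ F.card,
      ∃ y, a < y ∧ y ∉ C ∧ (F.filter (fun v => y < v)).card = j := by
  induction F using Finset.induction_on_min with
  | empty =>
    intro a _ j hj
    obtain ⟨y, hy, hyC⟩ := exists_mem_Ioo_notMem hC (lt_add_one a)
    exact ⟨y, hy.1, hyC, by simpa [eq_comm] using hj⟩
  | insert v F hv ih =>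
    intro a ha j hj
    have hvF : v ∉ F := fun h => lt_irrefl _ (hv v h)
    have hav : a < v := ha v (Finset.mem_insert_self _ _)
    rw [Finset.card_insert_of_notMem hvF] at hj
    rcases Nat.lt_or_ge j (F.card + 1) with h | h
    · obtain ⟨y, hy, hyC, hcard⟩ := ih v hv j (by omega)
      refine ⟨y, hav.trans hy, hyC, ?_⟩
      rw [Finset.filter_insert, if_neg hy.not_gt, hcard]
    · obtain ⟨y, hy, hyC⟩ := exists_mem_Ioo_notMem hC hav
      refine ⟨y, hy.1, hyC, ?_⟩
      rw [Finset.filter_true_of_mem, Finset.card_insert_of_notMem hvF]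
      · omega
      · intro w hw
        rcases Finset.mem_insert.mp hw with rfl | hw
        · exact hy.2
        · exact hy.2.trans (hv w hw)

theorem countable_span_range {m : ℕ} (x : Fin m → ℝ) :
    (Submodule.span ℚ (Set.range x) : Set ℝ).Countable := by
  rw [← Fintype.range_linearCombination ℚ x]
  exact Set.countable_range _

theorem injOn_triple_value {m : ℕ} {x : Fin m → ℝ} (hx : LinearIndependent ℚ x) :
    Set.InjOn (fun p : Fin m × Fin m × Fin m => x p.2.1 + x p.2.2 - x p.1)
      {p | p.1 < p.2.1 ∧ p.2.1 < p.2.2} := by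
  rintro ⟨i, k, l⟩ ⟨h1, h2⟩ ⟨i', k', l'⟩ ⟨h1', h2'⟩ h
  simp only at h h1 h2 h1' h2'
  have key : (Finsupp.single k 1 + Finsupp.single l 1 - Finsupp.single i 1 : Fin m →₀ ℚ) =
      Finsupp.single k' 1 + Finsupp.single l' 1 - Finsupp.single i' 1 := by
    apply hx
    simpa [Finsupp.linearCombination_single] using h
  have e := fun a => DFunLike.congr_fun key a
  simp only [Finsupp.coe_sub, Finsupp.coe_add, Pi.sub_apply, Pi.add_apply,
    Finsupp.single_apply] at e
  have ei := e i
  have ek := e k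
  have el := e l
  have hki : k ≠ i := h1.ne'
  have hli : l ≠ i := (h1.trans h2).ne'
  have hkl : k ≠ l := h2.ne
  have hki' : k' ≠ i' := h1'.ne'
  have hli' : l' ≠ i' := (h1'.trans h2').ne'
  have hkl' : k' ≠ l' := h2'.ne
  simp only [hki, hli, hkl, hki.symm, hli.symm, hkl.symm, if_true, if_false] at ei ek el
  have hi : i' = i := by
    by_contra hne
    simp only [hne, if_false] at ei
    split_ifs at ei <;> norm_num at ei
  subst hi
  have hk : k' = k ∨ l' = k := by
    by_contra! hne
    simp only [hne.1, hne.2, hki.symm, if_false] at ek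
    norm_num at ek
  have hl : k' = l ∨ l' = l := by
    by_contra! hne
    simp only [hne.1, hne.2, hli.symm, if_false] at el
    norm_num at el
  have : k' = k ∧ l' = l := by
    rcases hk with hk | hk
    · exact ⟨hk, hl.resolve_left fun h => hkl (hk.symm.trans h)⟩
    · rcases hl with hl | hl
      · subst hk hl
        exact absurd h2 h2'.not_gt
      · exact absurd (hk.symm.trans hl) hkl
  rw [this.1, this.2]

theorem choose_two_le_card_pairs (m : ℕ) :
    m.choose 2 ≤ (Finset.univ.filter (fun p : Fin m × Fin m => p.1 < p.2)).card := by
  have h : (Finset.univ.filter (fun p : Fin m × Fin m => p.1 < p.2)).card =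
      ∑ k : Fin m, (k : ℕ) := by
    rw [Finset.card_filter, Fintype.sum_prod_type_right]
    refine Finset.sum_congr rfl fun k _ => ?_
    rw [← Finset.card_filter, ← Fin.card_Iio k]
    congr 1
    ext i
    simp
  rw [h, Fin.sum_univ_eq_sum_range (fun k => k), Finset.sum_range_id, Nat.choose_two_right]

theorem choose_two_add_lastTripleCount_le {m : ℕ} {x : Fin (m + 1) → ℝ} (hx : StrictMono x) :
    m.choose 2 + lastTripleCount x ≤ tripleCount x (x (Fin.last m)) := by
  classical
  refine (Nat.add_le_add_right (choose_two_le_card_pairs m) _).trans ?_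
  unfold lastTripleCount tripleCount
  set A := Finset.univ.filter (fun p : Fin m × Fin m => p.1 < p.2)
  set B := Finset.univ.filter (fun p : Fin m × Fin m × Fin m => (p.1 < p.2.1 ∧ p.2.1 < p.2.2) ∧
    Fin.init x p.1 + x (Fin.last m) < Fin.init x p.2.1 + Fin.init x p.2.2)
  let f : Fin m × Fin m → Fin (m + 1) × Fin (m + 1) × Fin (m + 1) :=
    fun p => (p.1.castSucc, p.2.castSucc, Fin.last m)
  let g : Fin m × Fin m × Fin m → Fin (m + 1) × Fin (m + 1) × Fin (m + 1) :=
    fun p => (p.1.castSucc, p.2.1.castSucc, p.2.2.castSucc)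
  have hf : Function.Injective f := by
    rintro ⟨a, b⟩ ⟨c, d⟩ h
    simpa [f] using h
  have hg : Function.Injective g := by
    rintro ⟨a, b, e⟩ ⟨c, d, e'⟩ h
    simpa [g] using h
  rw [← Finset.card_image_of_injective A hf, ← Finset.card_image_of_injective B hg,
    ← Finset.card_union_of_disjoint]
  · refine Finset.card_le_card ?_
    intro q hq
    rcases Finset.mem_union.mp hq with hq | hq
    · obtain ⟨p, hp, rfl⟩ := Finset.mem_image.mp hq
      have hp' : p.1 < p.2 := by simpa [A] using hp
      have := hx (Fin.castSucc_lt_castSucc_iff.mpr hp')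
      simp [f, hp', Fin.castSucc_lt_last, this]
    · obtain ⟨p, hp, rfl⟩ := Finset.mem_image.mp hq
      exact Finset.mem_filter.mpr ⟨Finset.mem_univ _, by
        simpa [g, Fin.init] using (Finset.mem_filter.mp hp).2⟩
  · rw [Finset.disjoint_left]
    rintro q hq hq'
    obtain ⟨p, -, rfl⟩ := Finset.mem_image.mp hq
    obtain ⟨p', -, h⟩ := Finset.mem_image.mp hq'
    simp only [f, g, Prod.mk.injEq] at h
    exact (Fin.castSucc_lt_last p'.2.2).ne h.2.2

theorem strictMono_snoc {m : ℕ} {x : Fin (m + 1) → ℝ} (hx : StrictMono x) {y : ℝ}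
    (hy : x (Fin.last m) < y) :
    StrictMono (Fin.snoc x y : Fin (m + 2) → ℝ) := by
  rw [Fin.strictMono_iff_lt_succ]
  intro i
  refine Fin.lastCases ?_ (fun i => ?_) i
  · rw [Fin.succ_last]
    simpa using hy
  · rw [Fin.succ_castSucc]
    simpa only [Fin.snoc_castSucc] using hx (Fin.castSucc_lt_succ (i := i))

theorem exists_snoc {m : ℕ} {x : Fin (m + 1) → ℝ} (hx : StrictMono x)
    (hli : LinearIndependent ℚ x) {j : ℕ} (hj : j < 1 + m.choose 2 + lastTripleCount x) :
    ∃ y : ℝ, StrictMono (Fin.snoc x y : Fin (m + 2) → ℝ) ∧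
      LinearIndependent ℚ (Fin.snoc x y : Fin (m + 2) → ℝ) ∧
      lastTripleCount (Fin.snoc x y : Fin (m + 2) → ℝ) = j := by
  classical
  set T := Finset.univ.filter (fun p : Fin (m + 1) × Fin (m + 1) × Fin (m + 1) =>
    (p.1 < p.2.1 ∧ p.2.1 < p.2.2) ∧ x p.1 + x (Fin.last m) < x p.2.1 + x p.2.2) with hT
  let v : Fin (m + 1) × Fin (m + 1) × Fin (m + 1) → ℝ := fun p => x p.2.1 + x p.2.2 - x p.1
  have hinj : Set.InjOn v T := (injOn_triple_value hli).mono fun p hp => by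
    exact (Finset.mem_filter.mp hp).2.1
  have hcard : (T.image v).card = tripleCount x (x (Fin.last m)) :=
    Finset.card_image_of_injOn hinj
  have hle := choose_two_add_lastTripleCount_le hx
  obtain ⟨y, hy, hyC, hyj⟩ := exists_gt_card_filter_eq (countable_span_range x) (T.image v)
    (x (Fin.last m)) (by
      intro w hw
      obtain ⟨p, hp, rfl⟩ := Finset.mem_image.mp hw
      have := (Finset.mem_filter.mp hp).2.2
      simp only [v]
      linarith) j (by omega)
  refine ⟨y, strictMono_snoc hx hy, linearIndependent_finSnoc.mpr ⟨hli, hyC⟩, ?_⟩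
  rw [← hyj, Finset.filter_image, Finset.card_image_of_injOn
    (hinj.mono (Finset.coe_subset.mpr (Finset.filter_subset _ _)))]
  simp only [lastTripleCount, tripleCount, Fin.init_snoc, Fin.snoc_last]
  congr 1
  ext p
  simp only [hT, v, Finset.mem_filter, Finset.mem_univ, true_and]
  constructor
  · rintro ⟨h, h'⟩
    exact ⟨⟨h, by linarith⟩, by linarith⟩
  · rintro ⟨⟨h, -⟩, h'⟩
    exact ⟨h, by linarith⟩

theorem SameMidOrder.init {m : ℕ} {x x' : Fin (m + 1) → ℝ} (h : SameMidOrder x x') :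
    SameMidOrder (Fin.init x) (Fin.init x') := fun i j k l hil hjk =>
  h i.castSucc j.castSucc k.castSucc l.castSucc (Fin.castSucc_lt_castSucc_iff.mpr hil)
    (Fin.castSucc_lt_castSucc_iff.mpr hjk)

theorem SameMidOrder.lastTripleCount_eq {m : ℕ} {x x' : Fin (m + 1) → ℝ}
    (h : SameMidOrder x x') : lastTripleCount x = lastTripleCount x' := by
  unfold lastTripleCount tripleCount
  refine congrArg Finset.card (Finset.filter_congr fun p _ => ?_)
  exact and_congr_right fun hp => h _ _ _ _ (Fin.castSucc_lt_last _)
    (Fin.castSucc_lt_castSucc_iff.mpr hp.2)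

theorem IsIndependentFamily.exists_succ {m : ℕ} {S : Finset (Fin (m + 1) → ℝ)}
    (hS : IsIndependentFamily S) :
    ∃ S' : Finset (Fin (m + 2) → ℝ), IsIndependentFamily S' ∧
      S'.card = ∑ x ∈ S, (1 + m.choose 2 + lastTripleCount x) ∧
      m.choose 2 * S'.card ≤ 2 * ∑ x ∈ S', lastTripleCount x := by
  classical
  let N : (Fin (m + 1) → ℝ) → ℕ := fun x => 1 + m.choose 2 + lastTripleCount x
  have hex : ∀ (x : Fin (m + 1) → ℝ) (j : ℕ), ∃ y : ℝ, x ∈ S → j < N x →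
      StrictMono (Fin.snoc x y : Fin (m + 2) → ℝ) ∧
      LinearIndependent ℚ (Fin.snoc x y : Fin (m + 2) → ℝ) ∧
      lastTripleCount (Fin.snoc x y : Fin (m + 2) → ℝ) = j := by
    intro x j
    by_cases h : x ∈ S ∧ j < N x
    · obtain ⟨y, hy⟩ := exists_snoc (hS.strictMono x h.1) (hS.linearIndependent x h.1) h.2
      exact ⟨y, fun _ _ => hy⟩
    · exact ⟨0, fun h1 h2 => absurd ⟨h1, h2⟩ h⟩
  choose Y hY using hex
  let I : Finset (Σ _ : Fin (m + 1) → ℝ, ℕ) := S.sigma fun x => Finset.range (N x)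
  let φ : (Σ _ : Fin (m + 1) → ℝ, ℕ) → (Fin (m + 2) → ℝ) := fun p => Fin.snoc p.1 (Y p.1 p.2)
  have hI : ∀ p ∈ I, StrictMono (φ p) ∧ LinearIndependent ℚ (φ p) ∧
      lastTripleCount (φ p) = p.2 := by
    intro p hp
    obtain ⟨h1, h2⟩ := Finset.mem_sigma.mp hp
    exact hY p.1 p.2 h1 (Finset.mem_range.mp h2)
  have hsame : ∀ p ∈ I, ∀ q ∈ I, SameMidOrder (φ p) (φ q) → p = q := by
    intro p hp q hq h
    have h1 : p.1 = q.1 := by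
      have := h.init
      simp only [φ, Fin.init_snoc] at this
      exact hS.eq_of_same _ (Finset.mem_sigma.mp hp).1 _ (Finset.mem_sigma.mp hq).1 this
    have h2 : p.2 = q.2 := by
      rw [← (hI p hp).2.2, ← (hI q hq).2.2, h.lastTripleCount_eq]
    exact Sigma.ext h1 (heq_of_eq h2)
  have hinj : Set.InjOn φ I := fun p hp q hq h => hsame p hp q hq (by
    rw [h]
    exact fun _ _ _ _ _ _ => Iff.rfl)
  have hcard : (I.image φ).card = ∑ x ∈ S, N x := by
    rw [Finset.card_image_of_injOn hinj, Finset.card_sigma]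
    simp
  refine ⟨I.image φ, ⟨?_, ?_, ?_⟩, hcard, ?_⟩
  · simp only [Finset.mem_image]
    rintro _ ⟨p, hp, rfl⟩
    exact (hI p hp).1
  · simp only [Finset.mem_image]
    rintro _ ⟨p, hp, rfl⟩
    exact (hI p hp).2.1
  · simp only [Finset.mem_image]
    rintro _ ⟨p, hp, rfl⟩ _ ⟨q, hq, rfl⟩ h
    rw [hsame p hp q hq h]
  · have hsum : ∑ x ∈ I.image φ, lastTripleCount x = ∑ x ∈ S, ∑ j ∈ Finset.range (N x), j := by
      rw [Finset.sum_image hinj, Finset.sum_congr rfl fun p hp => (hI p hp).2.2,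
        Finset.sum_sigma]
    rw [hcard, hsum, Finset.mul_sum, Finset.mul_sum]
    refine Finset.sum_le_sum fun x _ => ?_
    rw [mul_comm 2, Finset.sum_range_id_mul_two, mul_comm]
    exact Nat.mul_le_mul_left _ (by simp only [N]; omega)

theorem exists_isIndependentFamily (n : ℕ) :
    ∃ S : Finset (Fin (n + 4) → ℝ), IsIndependentFamily S ∧
      (n + 2).choose 2 * S.card ≤ 2 * ∑ x ∈ S, lastTripleCount x ∧
      2 * (3 / 4 : ℝ) ^ n * ((n + 1).factorial : ℝ) ^ 2 ≤ S.card := by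
  induction n with
  | zero =>
    have h1 : IsIndependentFamily ({fun _ => 1} : Finset (Fin 1 → ℝ)) := by
      refine ⟨fun x _ => Subsingleton.strictMono x, ?_, ?_⟩
      · simp
      · simp
    obtain ⟨S2, h2, hc2, -⟩ := h1.exists_succ
    obtain ⟨S3, h3, hc3, -⟩ := h2.exists_succ
    obtain ⟨S4, h4, hc4, hs4⟩ := h3.exists_succ
    refine ⟨S4, h4, hs4, ?_⟩
    have e2 : 1 ≤ S2.card := by
      rw [hc2, Finset.sum_singleton]
      omega
    have e3 : S2.card ≤ S3.card := by
      rw [hc3, Finset.card_eq_sum_ones]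
      exact Finset.sum_le_sum fun x _ => by omega
    have e4 : 2 * S3.card ≤ S4.card := by
      rw [hc4, Finset.card_eq_sum_ones, Finset.mul_sum]
      exact Finset.sum_le_sum fun x _ => by simp
    have : 2 ≤ S4.card := by omega
    simpa using (Nat.cast_le (α := ℝ)).mpr this
  | succ n ih =>
    obtain ⟨S, hS, hs, hb⟩ := ih
    obtain ⟨S', hS', hc, hs'⟩ := hS.exists_succ
    refine ⟨S', hS', hs', ?_⟩
    have hcR : (S'.card : ℝ) = (1 + ((n + 3).choose 2 : ℕ)) * S.card +
        ((∑ x ∈ S, lastTripleCount x : ℕ) : ℝ) := by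
      rw [hc, Finset.sum_add_distrib, Finset.sum_const, smul_eq_mul]
      push_cast
      ring
    have hsR : (((n + 2).choose 2 : ℕ) : ℝ) * S.card ≤
        2 * ((∑ x ∈ S, lastTripleCount x : ℕ) : ℝ) := by exact_mod_cast hs
    rw [Nat.cast_choose_two] at hcR hsR
    push_cast at hcR hsR
    rw [hcR, Nat.factorial_succ (n + 1)]
    push_cast
    have hn : (0 : ℝ) ≤ n := n.cast_nonneg
    have hk : (0 : ℝ) ≤ 3 / 4 * ((n : ℝ) + 2) ^ 2 := by positivity
    have hS0 : (0 : ℝ) ≤ S.card := Nat.cast_nonneg _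
    have := mul_le_mul_of_nonneg_left hb hk
    have hpos : 0 ≤ (n : ℝ) * S.card := mul_nonneg hn hS0
    calc 2 * (3 / 4 : ℝ) ^ (n + 1) * (((n : ℝ) + 1 + 1) * ((n + 1).factorial : ℝ)) ^ 2
        = 3 / 4 * ((n : ℝ) + 2) ^ 2 * (2 * (3 / 4 : ℝ) ^ n * ((n + 1).factorial : ℝ) ^ 2) := by
          ring
      _ ≤ _ := this
      _ ≤ _ := by nlinarith

theorem abs_sub_lt_abs_sub_iff_of_lt {a b y : ℝ} (h : a < b) :
    |y - a| < |y - b| ↔ y < (a + b) / 2 := by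
  rw [← sq_lt_sq]
  constructor <;> intro h' <;> nlinarith

theorem abs_sub_lt_abs_sub_iff_of_gt {a b y : ℝ} (h : a < b) :
    |y - b| < |y - a| ↔ (a + b) / 2 < y := by
  rw [← sq_lt_sq]
  constructor <;> intro h' <;> nlinarith

theorem exists_mem_RPUF {m : ℕ} {x : Fin m → ℝ} (hx : StrictMono x) {a b : ℝ} (hab : a < b) :
    ∃ y ∈ Set.Ioo a b, ∃ σ : Equiv.Perm (Fin m),
      ∀ k l : Fin m, k < l → |y - x (σ k)| < |y - x (σ l)| := by
  have hC : (Set.range fun p : Fin m × Fin m => (x p.1 + x p.2) / 2).Countable :=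
    Set.countable_range _
  obtain ⟨y, hy, hyC⟩ := exists_mem_Ioo_notMem hC hab
  have hinj : Function.Injective fun i => |y - x i| := by
    intro i j hij
    rcases abs_eq_abs.mp hij with h | h
    · exact hx.injective (by linarith)
    · exact absurd ⟨(i, j), by simp only; linarith⟩ hyC
  refine ⟨y, hy, Tuple.sort fun i => |y - x i|, ?_⟩
  exact (Tuple.monotone_sort fun i => |y - x i|).strictMono_of_injective
    (hinj.comp (Equiv.injective _))

theorem add_lt_add_iff_exists_mem_RPUF {m : ℕ} {x : Fin m → ℝ} (hx : StrictMono x)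
    {i j k l : Fin m} (hil : i < l) (hjk : j < k) :
    x i + x l < x j + x k ↔
      ∃ σ ∈ RPUF x, σ.symm l < σ.symm i ∧ σ.symm j < σ.symm k := by
  have hlt : ∀ (σ : Equiv.Perm (Fin m)) (y : ℝ),
      (∀ k l : Fin m, k < l → |y - x (σ k)| < |y - x (σ l)|) →
      ∀ a b : Fin m, σ.symm a < σ.symm b ↔ |y - x a| < |y - x b| := by
    intro σ y h a b
    have hmono : StrictMono fun k => |y - x (σ k)| := h
    have := hmono.lt_iff_lt (a := σ.symm a) (b := σ.symm b)
    simpa using this.symm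
  constructor
  · intro h
    obtain ⟨y, ⟨hy1, hy2⟩, σ, hσ⟩ := exists_mem_RPUF hx
      (show (x i + x l) / 2 < (x j + x k) / 2 by linarith)
    refine ⟨σ, ⟨y, hσ⟩, ?_, ?_⟩
    · rw [hlt σ y hσ, abs_sub_lt_abs_sub_iff_of_gt (hx hil)]
      exact hy1
    · rw [hlt σ y hσ, abs_sub_lt_abs_sub_iff_of_lt (hx hjk)]
      exact hy2
  · rintro ⟨σ, ⟨y, hσ⟩, h1, h2⟩
    rw [hlt σ y hσ, abs_sub_lt_abs_sub_iff_of_gt (hx hil)] at h1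
    rw [hlt σ y hσ, abs_sub_lt_abs_sub_iff_of_lt (hx hjk)] at h2
    linarith

theorem sameMidOrder_of_RPUF_eq {m : ℕ} {x x' : Fin m → ℝ} (hx : StrictMono x)
    (hx' : StrictMono x') (h : RPUF x = RPUF x') : SameMidOrder x x' := by
  intro i j k l hil hjk
  rw [add_lt_add_iff_exists_mem_RPUF hx hil hjk, add_lt_add_iff_exists_mem_RPUF hx' hil hjk, h]

theorem notMem_midUnion {m : ℕ} {x : Fin m → ℝ} (hx : LinearIndependent ℚ x) :
    x ∉ midUnion m := by
  simp only [midUnion, Set.mem_iUnion, Set.mem_ofPred_eq, not_exists]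
  intro i j k l hij hik hkl hjk hjl h
  have key : (Finsupp.single i 1 + Finsupp.single j 1 : Fin m →₀ ℚ) =
      Finsupp.single k 1 + Finsupp.single l 1 := by
    apply hx
    simpa [Finsupp.linearCombination_single] using h
  have e := DFunLike.congr_fun key i
  simp [hij.ne', hik.ne', (hik.trans hkl).ne'] at e

theorem IsIndependentFamily.card_le_r0 {m : ℕ} {S : Finset (Fin m → ℝ)}
    (hS : IsIndependentFamily S) : S.card ≤ r0 m := by
  have hinj : Set.InjOn (RPUF (m := m)) S := fun x hx x' hx' h =>
    hS.eq_of_same x hx x' hx'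
      (sameMidOrder_of_RPUF_eq (hS.strictMono x hx) (hS.strictMono x' hx') h)
  rw [← Set.ncard_coe_finset, ← hinj.ncard_image]
  refine Set.ncard_le_ncard ?_ (Set.toFinite _)
  rintro _ ⟨x, hx, rfl⟩
  exact ⟨x, ⟨hS.strictMono x hx, notMem_midUnion (hS.linearIndependent x hx)⟩, rfl⟩

/-- Lower bound: for all `m ≥ 4`, `2·(3/4)^{m-4}·((m-3)!)² ≤ r_0(m)`. -/
theorem r0_lower_bound (m : ℕ) (hm : 4 ≤ m) :
    2 * (3 / 4 : ℝ) ^ (m - 4) * (Nat.factorial (m - 3) : ℝ) ^ 2 ≤ (r0 m : ℝ) := by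
  obtain ⟨n, rfl⟩ := Nat.exists_eq_add_of_le' hm
  obtain ⟨S, hS, -, hb⟩ := exists_isIndependentFamily n
  have h3 : n + 4 - 3 = n + 1 := by omega
  rw [Nat.add_sub_cancel, h3]
  exact hb.trans (Nat.cast_le.mpr hS.card_le_r0)
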